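/- Let d ∈ {1,2,3}, let Ω ⊆ ℝ^d be a nonempty bounded open set, let b, c > 0 and T > 0. There exists C_T > 0 (depending on d, Ω, b, c, T) such that: if ψ and f are admissible, v := ψ_t, and v_t − b Δv − c² Δψ = f on [0,T] × Ω, then sup_{t∈[0,T]} t‖v_t(t)‖² + ∫₀ᵀ t‖∇v_t(t)‖² dt ≤ C_T(‖ψ(0)‖_{H¹}² + ‖v(0)‖_{H¹}² + ∫₀ᵀ‖f(t)‖² dt + ∫₀ᵀ t‖f_t(t)‖_{H⁻¹(Ω)}² dt). -/

import Mathlib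

open MeasureTheory Real

noncomputable section

/-- Euclidean space ℝ^d. -/
abbrev Spc (d : ℕ) := EuclideanSpace ℝ (Fin d)

variable {d : ℕ}

/-- Spatial Laplacian: sum of second derivatives in the coordinate directions. -/
def lap (g : Spc d → ℝ) (x : Spc d) : ℝ :=
  ∑ i, fderiv ℝ (fun y => fderiv ℝ g y (EuclideanSpace.single i 1)) x (EuclideanSpace.single i 1)

/-- Squared L²(Ω) norm: ‖g‖² = ∫_Ω g². -/
def sqL2 (Ω : Set (Spc d)) (g : Spc d → ℝ) : ℝ := ∫ x in Ω, (g x) ^ 2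

/-- Squared L²(Ω) norm of the gradient: ‖∇g‖² = ∫_Ω |∇g|². -/
def sqGrad (Ω : Set (Spc d)) (g : Spc d → ℝ) : ℝ := ∫ x in Ω, ‖gradient g x‖ ^ 2

/-- Squared L²(Ω) norm of the Hessian: ‖D²g‖² = ∫_Ω |D²g|². -/
def sqHess (Ω : Set (Spc d)) (g : Spc d → ℝ) : ℝ := ∫ x in Ω, ‖iteratedFDeriv ℝ 2 g x‖ ^ 2

/-- Squared H¹(Ω) norm. -/
def sqH1 (Ω : Set (Spc d)) (g : Spc d → ℝ) : ℝ := sqL2 Ω g + sqGrad Ω g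

/-- Squared H²(Ω) norm. -/
def sqH2 (Ω : Set (Spc d)) (g : Spc d → ℝ) : ℝ := sqL2 Ω g + sqGrad Ω g + sqHess Ω g

/-- H⁻¹(Ω) norm by duality against smooth compactly supported test functions. -/
def negH1 (Ω : Set (Spc d)) (g : Spc d → ℝ) : ℝ :=
  sSup { r : ℝ | ∃ φ : Spc d → ℝ, ContDiff ℝ (⊤ : ℕ∞) φ ∧ HasCompactSupport φ ∧ tsupport φ ⊆ Ω ∧
      (∫ x in Ω, ‖gradient φ x‖ ^ 2) ≤ 1 ∧ r = ∫ x in Ω, g x * φ x }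

/-- Admissible: smooth in (t,x), with spatial support in a fixed compact subset of Ω. -/
def Admissible (Ω : Set (Spc d)) (w : ℝ → Spc d → ℝ) : Prop :=
  ContDiff ℝ (⊤ : ℕ∞) (fun p : ℝ × Spc d => w p.1 p.2) ∧
  ∃ K : Set (Spc d), IsCompact K ∧ K ⊆ Ω ∧ ∀ t, Function.support (w t) ⊆ K

/-- Inner product of two spatial gradients: ∇g·∇h. -/
def gdot (g h : Spc d → ℝ) (x : Spc d) : ℝ := @inner ℝ _ _ (gradient g x) (gradient h x)

/-- Time derivative. -/
def tderiv (w : ℝ → Spc d → ℝ) (t : ℝ) (x : Spc d) : ℝ := deriv (fun s => w s x) t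

/-- The Blackstock equation ψ_tt − c²(1 − 2k ψ_t)Δψ − b Δψ_t + 2σ ∇ψ·∇ψ_t = 0
holds at time `t` on `Ω`. -/
def IsBlackstock (Ω : Set (Spc d)) (b c k σ : ℝ) (ψ : ℝ → Spc d → ℝ) (t : ℝ) : Prop :=
  ∀ x ∈ Ω,
    (tderiv (tderiv ψ) t x - c ^ 2 * (1 - 2 * k * tderiv ψ t x) * lap (ψ t) x
      - b * lap (tderiv ψ t) x
      + 2 * σ * gdot (ψ t) (tderiv ψ t) x) = 0

/-- Energy E(t). -/
def energy (Ω : Set (Spc d)) (b c : ℝ) (ψ : ℝ → Spc d → ℝ) (t : ℝ) : ℝ :=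
  (1 / 2) * sqL2 Ω (tderiv ψ t) + (c ^ 2 / 2) * sqGrad Ω (ψ t)
    + (c ^ 2 / (2 * b)) * sqL2 Ω (lap (ψ t)) + sqGrad Ω (tderiv ψ t)

/-- Dissipation D(t). -/
def dissip (Ω : Set (Spc d)) (ψ : ℝ → Spc d → ℝ) (t : ℝ) : ℝ :=
  ∫ s in (0:ℝ)..t,
    (sqGrad Ω (tderiv ψ s) + sqL2 Ω (lap (tderiv ψ s)) + sqGrad Ω (ψ s)
      + sqL2 Ω (lap (ψ s)) + sqL2 Ω (tderiv (tderiv ψ) s))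

/-- Supremum of a function of time over [0,T]. -/
def supIcc (T : ℝ) (f : ℝ → ℝ) : ℝ := ⨆ t : Set.Icc (0:ℝ) T, f t

/-- f := −2k c² ψ_t Δψ − 2σ ∇ψ·∇ψ_t, the right-hand side nonlinearity. -/
def blackF (c k σ : ℝ) (ψ : ℝ → Spc d → ℝ) (t : ℝ) (x : Spc d) : ℝ :=
  -(2 * k * c ^ 2) * tderiv ψ t x * lap (ψ t) x - 2 * σ * gdot (ψ t) (tderiv ψ t) x

/-- The nonlocal heat equation v_t − b Δv − c² Δψ = f (with v = ψ_t) holds at time `t` on `Ω`. -/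
def IsHeat (Ω : Set (Spc d)) (b c : ℝ) (ψ f : ℝ → Spc d → ℝ) (t : ℝ) : Prop :=
  ∀ x ∈ Ω,
    tderiv (tderiv ψ) t x - b * lap (tderiv ψ t) x - c ^ 2 * lap (ψ t) x = f t x

/-- The linearized Blackstock equation
ψ_tt − c²(1 − 2k α)Δψ − b Δψ_t + 2σ ∇ψ·∇α = f̃ holds at time `t` on `Ω`. -/
def IsLinBlackstock (Ω : Set (Spc d)) (b c k σ : ℝ) (α ψ f : ℝ → Spc d → ℝ) (t : ℝ) : Prop :=
  ∀ x ∈ Ω,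
    tderiv (tderiv ψ) t x - c ^ 2 * (1 - 2 * k * α t x) * lap (ψ t) x
      - b * lap (tderiv ψ t) x + 2 * σ * gdot (ψ t) (α t) x = f t x

/-- Time-weighted norm N_T^v for the velocity variable. -/
def normV (Ω : Set (Spc d)) (T : ℝ) (α : ℝ → Spc d → ℝ) : ℝ :=
  supIcc T (fun t => Real.sqrt (sqH1 Ω (α t)))
    + Real.sqrt (∫ t in (0:ℝ)..T, (sqL2 Ω (α t) + sqGrad Ω (α t) + sqL2 Ω (lap (α t))))
    + Real.sqrt (∫ t in (0:ℝ)..T, sqL2 Ω (tderiv α t))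
    + supIcc T (fun t => Real.sqrt t * Real.sqrt (sqL2 Ω (tderiv α t)))
    + Real.sqrt (∫ t in (0:ℝ)..T, t * sqGrad Ω (tderiv α t))
    + supIcc T (fun t => Real.sqrt t * Real.sqrt (sqL2 Ω (lap (α t))))

/-- Time-weighted solution norm N_T(ψ) = sup_{[0,T]} ‖ψ(t)‖_{H²} + N_T^v(ψ_t). -/
def normX (Ω : Set (Spc d)) (T : ℝ) (ψ : ℝ → Spc d → ℝ) : ℝ :=
  supIcc T (fun t => Real.sqrt (sqH2 Ω (ψ t))) + normV Ω T (tderiv ψ)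

/-! ### Spatial partial derivatives and closure properties of admissible functions -/

/-- Spatial partial derivative in the `i`-th coordinate direction. -/
def pd (i : Fin d) (w : ℝ → Spc d → ℝ) (t : ℝ) (x : Spc d) : ℝ :=
  fderiv ℝ (w t) x (EuclideanSpace.single i 1)

/-- The uncurried function. -/
def unc (w : ℝ → Spc d → ℝ) (p : ℝ × Spc d) : ℝ := w p.1 p.2

lemma tderiv_hasDerivAt {w : ℝ → Spc d → ℝ} (hw : ContDiff ℝ (⊤ : ℕ∞) (unc w)) (t : ℝ)
    (x : Spc d) : HasDerivAt (fun s => w s x) (fderiv ℝ (unc w) (t, x) (1, 0)) t := by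
  have h1 : HasFDerivAt (unc w) (fderiv ℝ (unc w) (t, x)) (t, x) :=
    (hw.differentiable (by simp) (t, x)).hasFDerivAt
  have h2 : HasDerivAt (fun s : ℝ => (s, x)) ((1 : ℝ), (0 : Spc d)) t :=
    (hasDerivAt_id t).prodMk (hasDerivAt_const t x)
  exact h1.comp_hasDerivAt t h2

lemma tderiv_eq {w : ℝ → Spc d → ℝ} (hw : ContDiff ℝ (⊤ : ℕ∞) (unc w)) (t : ℝ) (x : Spc d) :
    tderiv w t x = fderiv ℝ (unc w) (t, x) (1, 0) :=
  (tderiv_hasDerivAt hw t x).deriv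

lemma pd_eq {w : ℝ → Spc d → ℝ} (hw : ContDiff ℝ (⊤ : ℕ∞) (unc w)) (i : Fin d) (t : ℝ)
    (x : Spc d) :
    pd i w t x = fderiv ℝ (unc w) (t, x) (0, EuclideanSpace.single i 1) := by
  have h1 : HasFDerivAt (unc w) (fderiv ℝ (unc w) (t, x)) (t, x) :=
    (hw.differentiable (by simp) (t, x)).hasFDerivAt
  have h2 : HasFDerivAt (fun y : Spc d => (t, y)) (ContinuousLinearMap.inr ℝ ℝ (Spc d)) x :=
    hasFDerivAt_prodMk_right t x
  have h3 : HasFDerivAt (w t) ((fderiv ℝ (unc w) (t, x)).comp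
      (ContinuousLinearMap.inr ℝ ℝ (Spc d))) x := h1.comp x h2
  rw [pd, h3.fderiv]
  simp

lemma contDiff_fderiv_apply {w : ℝ → Spc d → ℝ} (hw : ContDiff ℝ (⊤ : ℕ∞) (unc w))
    (e : ℝ × Spc d) : ContDiff ℝ (⊤ : ℕ∞) (fun p => fderiv ℝ (unc w) p e) := by
  have : ContDiff ℝ (⊤ : ℕ∞) (fderiv ℝ (unc w)) := hw.fderiv_right (by simp)
  exact this.clm_apply contDiff_const

lemma unc_tderiv {w : ℝ → Spc d → ℝ} (hw : ContDiff ℝ (⊤ : ℕ∞) (unc w)) :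
    unc (tderiv w) = fun p => fderiv ℝ (unc w) p (1, 0) := by
  ext ⟨t, x⟩
  exact tderiv_eq hw t x

lemma unc_pd {w : ℝ → Spc d → ℝ} (hw : ContDiff ℝ (⊤ : ℕ∞) (unc w)) (i : Fin d) :
    unc (pd i w) = fun p => fderiv ℝ (unc w) p (0, EuclideanSpace.single i 1) := by
  ext ⟨t, x⟩
  exact pd_eq hw i t x

lemma fderiv_fderiv_apply {w : ℝ → Spc d → ℝ} (hw : ContDiff ℝ (⊤ : ℕ∞) (unc w))
    (p e e' : ℝ × Spc d) :
    fderiv ℝ (fun q => fderiv ℝ (unc w) q e) p e' = fderiv ℝ (fderiv ℝ (unc w)) p e' e := by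
  have : ContDiff ℝ (⊤ : ℕ∞) (fderiv ℝ (unc w)) := hw.fderiv_right (by simp)
  have h := (this.differentiable (by simp) p).hasFDerivAt
  have h2 := h.clm_apply (hasFDerivAt_const e p)
  rw [h2.fderiv]
  simp

lemma tderiv_pd {w : ℝ → Spc d → ℝ} (hw : ContDiff ℝ (⊤ : ℕ∞) (unc w)) (i : Fin d) :
    tderiv (pd i w) = pd i (tderiv w) := by
  have h1 : ContDiff ℝ (⊤ : ℕ∞) (unc (pd i w)) := by
    rw [unc_pd hw]; exact contDiff_fderiv_apply hw _
  have h2 : ContDiff ℝ (⊤ : ℕ∞) (unc (tderiv w)) := by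
    rw [unc_tderiv hw]; exact contDiff_fderiv_apply hw _
  ext t x
  rw [tderiv_eq h1, pd_eq h2, unc_pd hw, unc_tderiv hw, fderiv_fderiv_apply hw,
    fderiv_fderiv_apply hw]
  exact (hw.contDiffAt.isSymmSndFDerivAt (by
    simpa using WithTop.coe_le_coe.2 (le_top : (2:ℕ∞) ≤ ⊤))) _ _

section Adm
variable {Ω : Set (Spc d)} {u w : ℝ → Spc d → ℝ}

lemma Admissible.cd (hw : Admissible Ω w) : ContDiff ℝ (⊤ : ℕ∞) (unc w) := hw.1

lemma Admissible.slice (hw : Admissible Ω w) (t : ℝ) : ContDiff ℝ (⊤ : ℕ∞) (w t) := by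
  have : w t = unc w ∘ (fun x => (t, x)) := rfl
  rw [this]
  exact hw.cd.comp (contDiff_const.prodMk contDiff_id)

lemma Admissible.tsub (hw : Admissible Ω w) :
    ∃ K : Set (Spc d), IsCompact K ∧ K ⊆ Ω ∧ ∀ t, tsupport (w t) ⊆ K := by
  obtain ⟨K, hK, hKΩ, h⟩ := hw.2
  exact ⟨K, hK, hKΩ, fun t => closure_minimal (h t) hK.isClosed⟩

lemma Admissible.compactSupport (hw : Admissible Ω w) (t : ℝ) : HasCompactSupport (w t) := by
  obtain ⟨K, hK, hKΩ, h⟩ := hw.tsub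
  exact hK.of_isClosed_subset (isClosed_tsupport _) (h t)

lemma Admissible.tsupport_subset (hw : Admissible Ω w) (t : ℝ) : tsupport (w t) ⊆ Ω := by
  obtain ⟨K, hK, hKΩ, h⟩ := hw.tsub
  exact (h t).trans hKΩ

lemma Admissible.zero_off (hw : Admissible Ω w) (t : ℝ) (x : Spc d) (hx : x ∉ Ω) : w t x = 0 := by
  obtain ⟨K, hK, hKΩ, h⟩ := hw.2
  by_contra h0
  exact hx (hKΩ (h t h0))

lemma Admissible.tderiv (hw : Admissible Ω w) : Admissible Ω (tderiv w) := by
  refine ⟨?_, ?_⟩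
  · change ContDiff ℝ (⊤ : ℕ∞) (unc (_root_.tderiv w))
    rw [unc_tderiv hw.cd]; exact contDiff_fderiv_apply hw.cd _
  · obtain ⟨K, hK, hKΩ, h⟩ := hw.2
    refine ⟨K, hK, hKΩ, fun t x hx => ?_⟩
    by_contra hxK
    apply hx
    have : (fun s => w s x) = fun _ => 0 := by
      ext s
      by_contra h0
      exact hxK (h s h0)
    simp [_root_.tderiv, this]

lemma Admissible.pd (hw : Admissible Ω w) (i : Fin d) : Admissible Ω (pd i w) := by
  refine ⟨?_, ?_⟩
  · change ContDiff ℝ (⊤ : ℕ∞) (unc (_root_.pd i w))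
    rw [unc_pd hw.cd]; exact contDiff_fderiv_apply hw.cd _
  · obtain ⟨K, hK, hKΩ, h⟩ := hw.tsub
    refine ⟨K, hK, hKΩ, fun t x hx => ?_⟩
    by_contra hxK
    apply hx
    have : fderiv ℝ (w t) x = 0 := by
      by_contra h0
      exact hxK (h t (support_fderiv_subset ℝ h0))
    simp [_root_.pd, this]

/-- admissible function times smooth function -/
lemma Admissible.mul_smooth (hw : Admissible Ω w) (hu : ContDiff ℝ (⊤ : ℕ∞) (unc u)) :
    Admissible Ω (fun t x => u t x * w t x) := by
  refine ⟨ContDiff.mul hu hw.cd, ?_⟩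
  obtain ⟨K, hK, hKΩ, h⟩ := hw.2
  refine ⟨K, hK, hKΩ, fun t x hx => h t ?_⟩
  intro h0
  apply hx
  simp [h0]

lemma Admissible.mul (hu : Admissible Ω u) (hw : Admissible Ω w) :
    Admissible Ω (fun t x => u t x * w t x) := hw.mul_smooth hu.cd

lemma Admissible.const_mul (hw : Admissible Ω w) (a : ℝ) :
    Admissible Ω (fun t x => a * w t x) :=
  hw.mul_smooth (u := fun _ _ => a) contDiff_const

lemma Admissible.add (hu : Admissible Ω u) (hw : Admissible Ω w) :
    Admissible Ω (fun t x => u t x + w t x) := by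
  refine ⟨ContDiff.add hu.cd hw.cd, ?_⟩
  obtain ⟨K, hK, hKΩ, h⟩ := hw.2
  obtain ⟨K', hK', hKΩ', h'⟩ := hu.2
  refine ⟨K ∪ K', hK.union hK', Set.union_subset hKΩ hKΩ', fun t x hx => ?_⟩
  by_contra hn
  rw [Set.mem_union, not_or] at hn
  apply hx
  have h1 : w t x = 0 := by
    by_contra h0; exact hn.1 (h t h0)
  have h2 : u t x = 0 := by
    by_contra h0; exact hn.2 (h' t h0)
  simp [h1, h2]

lemma Admissible.sum {U : Fin d → ℝ → Spc d → ℝ} (hU : ∀ i, Admissible Ω (U i))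
    (s : Finset (Fin d)) : Admissible Ω (fun t x => ∑ i ∈ s, U i t x) := by
  classical
  induction s using Finset.induction_on with
  | empty =>
    refine ⟨by simpa using contDiff_const, ∅, isCompact_empty, by simp, by simp⟩
  | insert a s ha ih =>
    have := (hU a).add ih
    simpa [Finset.sum_insert ha] using this

lemma Admissible.integrable (hw : Admissible Ω w) (t : ℝ) : Integrable (w t) :=
  (hw.slice t).continuous.integrable_of_hasCompactSupport (hw.compactSupport t)

lemma Admissible.setIntegral (hw : Admissible Ω w) (t : ℝ) :
    ∫ x in Ω, w t x = ∫ x, w t x :=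
  setIntegral_eq_integral_of_forall_compl_eq_zero (fun x hx => hw.zero_off t x hx)

lemma Admissible.hasDerivAt_integral (hw : Admissible Ω w) (t : ℝ) :
    HasDerivAt (fun s => ∫ x in Ω, w s x) (∫ x in Ω, _root_.tderiv w t x) t := by
  have e1 : (fun s => ∫ x in Ω, w s x) = fun s => ∫ x, w s x := by
    ext s; exact hw.setIntegral s
  rw [e1, hw.tderiv.setIntegral t]
  obtain ⟨K, hK, hKΩ, h⟩ := hw.tderiv.2
  obtain ⟨C, hC⟩ := ((isCompact_Icc (a := t - 1) (b := t + 1)).prod hK).exists_bound_of_continuousOn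
    (f := unc (_root_.tderiv w)) hw.tderiv.cd.continuous.continuousOn
  refine (hasDerivAt_integral_of_dominated_loc_of_deriv_le (μ := volume)
    (F := w) (F' := _root_.tderiv w) (s := Set.Icc (t - 1) (t + 1))
    (bound := K.indicator (fun _ => C)) ?_ ?_ ?_ ?_ ?_ ?_ ?_).2
  · exact Icc_mem_nhds (by linarith) (by linarith)
  · exact Filter.Eventually.of_forall fun s => (hw.integrable s).aestronglyMeasurable
  · exact hw.integrable t
  · exact (hw.tderiv.integrable t).aestronglyMeasurable
  · refine Filter.Eventually.of_forall fun x s hs => ?_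
    by_cases hx : x ∈ K
    · rw [Set.indicator_of_mem hx]
      exact hC (s, x) ⟨hs, hx⟩
    · rw [Set.indicator_of_notMem hx]
      have : _root_.tderiv w s x = 0 := by
        by_contra h0; exact hx (h s h0)
      simp [this]
  · exact (integrable_indicator_iff hK.measurableSet).2
      (integrableOn_const hK.measure_lt_top.ne)
  · refine Filter.Eventually.of_forall fun x s hs => ?_
    have := tderiv_hasDerivAt hw.cd s x
    rw [← tderiv_eq hw.cd] at this
    exact this

lemma tderiv_mul (hu : Admissible Ω u) (hw : Admissible Ω w) :
    tderiv (fun t x => u t x * w t x) =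
      fun t x => tderiv u t x * w t x + u t x * tderiv w t x := by
  ext t x
  have h1 := tderiv_hasDerivAt hu.cd t x
  have h2 := tderiv_hasDerivAt hw.cd t x
  rw [tderiv_eq hu.cd, tderiv_eq hw.cd]
  exact (h1.mul h2).deriv

/-! ### Bilinear forms -/

/-- The `L²(Ω)` pairing. -/
def BB (Ω : Set (Spc d)) (u w : ℝ → Spc d → ℝ) (t : ℝ) : ℝ := ∫ x in Ω, u t x * w t x

/-- The Dirichlet form. -/
def GG (Ω : Set (Spc d)) (u w : ℝ → Spc d → ℝ) (t : ℝ) : ℝ :=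
  ∑ i, BB Ω (pd i u) (pd i w) t

lemma BB_int (hu : Admissible Ω u) (hw : Admissible Ω w) (t : ℝ) :
    IntegrableOn (fun x => u t x * w t x) Ω :=
  ((hu.mul hw).integrable t).integrableOn

lemma BB_hasDerivAt (hu : Admissible Ω u) (hw : Admissible Ω w) (t : ℝ) :
    HasDerivAt (BB Ω u w) (BB Ω (tderiv u) w t + BB Ω u (tderiv w) t) t := by
  have := (hu.mul hw).hasDerivAt_integral t
  rw [tderiv_mul hu hw, integral_add (BB_int hu.tderiv hw t) (BB_int hu hw.tderiv t)] at this
  exact this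

lemma GG_hasDerivAt (hu : Admissible Ω u) (hw : Admissible Ω w) (t : ℝ) :
    HasDerivAt (GG Ω u w) (GG Ω (tderiv u) w t + GG Ω u (tderiv w) t) t := by
  have : HasDerivAt (fun s => ∑ i, BB Ω (pd i u) (pd i w) s)
      (∑ i, (BB Ω (tderiv (pd i u)) (pd i w) t + BB Ω (pd i u) (tderiv (pd i w)) t)) t :=
    HasDerivAt.fun_sum fun i _ => BB_hasDerivAt (hu.pd i) (hw.pd i) t
  simp only [tderiv_pd hu.cd, tderiv_pd hw.cd, Finset.sum_add_distrib] at this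
  exact this

lemma BB_comm (t : ℝ) : BB Ω u w t = BB Ω w u t := by
  simp only [BB, mul_comm]

lemma GG_comm (t : ℝ) : GG Ω u w t = GG Ω w u t := by
  simp only [GG, BB_comm (Ω := Ω) (u := pd _ u)]

lemma BB_young (hu : Admissible Ω u) (hw : Admissible Ω w) (p t : ℝ) :
    2 * p * BB Ω u w t ≤ p ^ 2 * BB Ω u u t + BB Ω w w t := by
  simp only [BB]
  rw [← integral_const_mul, ← integral_const_mul, ← integral_add]
  · refine integral_mono ?_ ?_ fun x => ?_
    · exact (BB_int hu hw t).const_mul _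
    · exact ((BB_int hu hu t).const_mul _).add (BB_int hw hw t)
    · change 2 * p * (u t x * w t x) ≤ p ^ 2 * (u t x * u t x) + w t x * w t x
      nlinarith [sq_nonneg (p * u t x - w t x)]
  · exact (BB_int hu hu t).const_mul _
  · exact (BB_int hw hw t)

lemma BB_nonneg (t : ℝ) : 0 ≤ BB Ω u u t :=
  integral_nonneg fun x => mul_self_nonneg _

lemma GG_nonneg (t : ℝ) : 0 ≤ GG Ω u u t :=
  Finset.sum_nonneg fun _ _ => BB_nonneg t

lemma GG_young (hu : Admissible Ω u) (hw : Admissible Ω w) (p t : ℝ) :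
    2 * p * GG Ω u w t ≤ p ^ 2 * GG Ω u u t + GG Ω w w t := by
  simp only [GG]
  rw [Finset.mul_sum, Finset.mul_sum, ← Finset.sum_add_distrib]
  exact Finset.sum_le_sum fun i _ => BB_young (hu.pd i) (hw.pd i) p t

lemma sqL2_eq (t : ℝ) : sqL2 Ω (u t) = BB Ω u u t := by
  simp only [sqL2, BB, sq]

lemma norm_gradient_sq (g : Spc d → ℝ) (x : Spc d) :
    ‖gradient g x‖ ^ 2 = ∑ i, fderiv ℝ g x (EuclideanSpace.single i 1) *
      fderiv ℝ g x (EuclideanSpace.single i 1) := by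
  rw [EuclideanSpace.norm_sq_eq]
  refine Finset.sum_congr rfl fun i _ => ?_
  have : gradient g x i = fderiv ℝ g x (EuclideanSpace.single i 1) := by
    have h := InnerProductSpace.toDual_symm_apply (𝕜 := ℝ) (x := EuclideanSpace.single i (1:ℝ))
      (y := fderiv ℝ g x)
    rw [← h, EuclideanSpace.inner_single_right]
    simp [gradient]
  rw [this, Real.norm_eq_abs, sq_abs, sq]

lemma sqGrad_eq (hu : Admissible Ω u) (t : ℝ) : sqGrad Ω (u t) = GG Ω u u t := by
  simp only [sqGrad, norm_gradient_sq, GG, BB]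
  rw [integral_finsetSum]
  · rfl
  · intro i _
    exact BB_int (hu.pd i) (hu.pd i) t

lemma ibp (hu : Admissible Ω u) (hw : Admissible Ω w) (i : Fin d) (t : ℝ) :
    BB Ω (pd i u) w t = - BB Ω u (pd i w) t := by
  simp only [BB]
  rw [((hu.pd i).mul hw).setIntegral t, (hu.mul (hw.pd i)).setIntegral t]
  have := integral_mul_fderiv_eq_neg_fderiv_mul_of_integrable (μ := volume)
    (f := u t) (g := w t) (v := EuclideanSpace.single i (1:ℝ))
    (((hu.pd i).mul hw).integrable t) ((hu.mul (hw.pd i)).integrable t)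
    ((hu.mul hw).integrable t) (fun x _ => (hu.slice t).differentiable (by simp) x)
    (fun x _ => (hw.slice t).differentiable (by simp) x)
  simp only [pd]
  rw [this, neg_neg]

/-- Space-time Laplacian. -/
def LL (u : ℝ → Spc d → ℝ) (t : ℝ) (x : Spc d) : ℝ := ∑ i, pd i (pd i u) t x

lemma lap_eq (t : ℝ) (x : Spc d) : lap (u t) x = LL u t x := rfl

lemma Admissible.LL (hu : Admissible Ω u) : Admissible Ω (LL u) :=
  Admissible.sum (fun i => (hu.pd i).pd i) Finset.univ

lemma tderiv_LL (hu : Admissible Ω u) : tderiv (LL u) = LL (tderiv u) := by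
  ext t x
  have : HasDerivAt (fun s => ∑ i, pd i (pd i u) s x) (∑ i, tderiv (pd i (pd i u)) t x) t := by
    refine HasDerivAt.fun_sum fun i _ => ?_
    have hh := ((hu.pd i).pd i).cd
    rw [tderiv_eq hh]
    exact tderiv_hasDerivAt hh t x
  have h2 : tderiv (LL u) t x = _ := this.deriv
  rw [h2]
  simp only [LL]
  refine Finset.sum_congr rfl fun i _ => ?_
  rw [tderiv_pd (hu.pd i).cd, tderiv_pd hu.cd]

lemma green (hu : Admissible Ω u) (hw : Admissible Ω w) (t : ℝ) :
    BB Ω (LL u) w t = - GG Ω u w t := by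
  have : BB Ω (LL u) w t = ∑ i, BB Ω (pd i (pd i u)) w t := by
    simp only [BB, LL, Finset.sum_mul]
    rw [integral_finsetSum]
    intro i _
    exact BB_int ((hu.pd i).pd i) hw t
  rw [this, GG, ← Finset.sum_neg_distrib]
  exact Finset.sum_congr rfl fun i _ => ibp (hu.pd i) hw i t

end Adm

/-! ### Poincaré inequality and the dual norm -/

section Dual
variable {Ω : Set (Spc d)}

lemma poincare (hd : 0 < d) (hbd : Bornology.IsBounded Ω) :
    ∃ P : ℝ, 0 ≤ P ∧ ∀ u : ℝ → Spc d → ℝ, Admissible Ω u → ∀ t,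
      BB Ω u u t ≤ P * GG Ω u u t := by
  obtain ⟨R, hR⟩ := hbd.exists_norm_le
  let i : Fin d := ⟨0, hd⟩
  refine ⟨4 * R ^ 2, by positivity, fun u hu t => ?_⟩
  have hX : ContDiff ℝ (⊤ : ℕ∞) (unc (fun (_ : ℝ) (x : Spc d) => x i)) := by
    have : ContDiff ℝ (⊤ : ℕ∞) (fun p : ℝ × Spc d => p.2 i) := by fun_prop
    exact this
  have h1 := hu.mul_smooth hX
  have h2 := (hu.pd i).mul_smooth hX
  have e1 : BB Ω (pd i (fun t x => x i * u t x)) u t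
      = BB Ω u u t + BB Ω (fun t x => x i * pd i u t x) u t := by
    simp only [BB]
    rw [← integral_add (BB_int hu hu t) (BB_int h2 hu t)]
    congr 1
    ext x
    have hx : HasFDerivAt (fun y : Spc d => y i) (EuclideanSpace.proj i : Spc d →L[ℝ] ℝ) x :=
      (EuclideanSpace.proj i : Spc d →L[ℝ] ℝ).hasFDerivAt
    have hux : HasFDerivAt (u t) (fderiv ℝ (u t) x) x :=
      ((hu.slice t).differentiable (by simp) x).hasFDerivAt
    have := (hx.mul hux).fderiv
    have h3 : pd i (fun t x => x i * u t x) t x = x i * pd i u t x + u t x := by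
      simp only [pd]
      erw [this]
      simp
    rw [h3]; ring
  have e2 : BB Ω (fun t x => x i * u t x) (pd i u) t
      = BB Ω (fun t x => x i * pd i u t x) u t := by
    simp only [BB]
    congr 1
    ext x
    ring
  have e3 := ibp h1 hu i t
  have e4 := BB_young h2 hu (-2) t
  have e5 : BB Ω (fun t x => x i * pd i u t x) (fun t x => x i * pd i u t x) t
      ≤ R ^ 2 * BB Ω (pd i u) (pd i u) t := by
    simp only [BB]
    rw [← integral_const_mul]
    refine integral_mono (BB_int h2 h2 t) ((BB_int (hu.pd i) (hu.pd i) t).const_mul _) fun x => ?_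
    change x i * pd i u t x * (x i * pd i u t x) ≤ R ^ 2 * (pd i u t x * pd i u t x)
    by_cases hx : x ∈ Ω
    · have hn : |x i| ≤ R := by
        have h1 : ‖x i‖ ≤ ‖x‖ := PiLp.norm_apply_le x i
        rw [Real.norm_eq_abs] at h1
        exact h1.trans (hR x hx)
      have : x i ^ 2 ≤ R ^ 2 := sq_le_sq.2 (hn.trans (le_abs_self R))
      nlinarith [mul_le_mul_of_nonneg_right this (mul_self_nonneg (pd i u t x))]
    · simp [(hu.pd i).zero_off t x hx]
  have e6 : BB Ω (pd i u) (pd i u) t ≤ GG Ω u u t :=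
    Finset.single_le_sum (f := fun i => BB Ω (pd i u) (pd i u) t)
      (fun i _ => BB_nonneg t) (Finset.mem_univ i)
  have e7 := mul_le_mul_of_nonneg_left e6 (sq_nonneg R)
  linarith

/-- Test functions for the dual norm. -/
def TestFn (Ω : Set (Spc d)) : Type :=
  {φ : Spc d → ℝ // ContDiff ℝ (⊤ : ℕ∞) φ ∧ HasCompactSupport φ ∧ tsupport φ ⊆ Ω ∧
      (∫ x in Ω, ‖gradient φ x‖ ^ 2) ≤ 1}

lemma negH1_eq (g : Spc d → ℝ) : negH1 Ω g = ⨆ φ : TestFn Ω, ∫ x in Ω, g x * φ.1 x := by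
  unfold negH1 iSup
  congr 1
  ext r
  constructor
  · rintro ⟨φ, h1, h2, h3, h4, h5⟩
    exact ⟨⟨φ, h1, h2, h3, h4⟩, h5.symm⟩
  · rintro ⟨⟨φ, h1, h2, h3, h4⟩, h5⟩
    exact ⟨φ, h1, h2, h3, h4, h5.symm⟩

lemma admissible_of_test {φ : Spc d → ℝ} (h1 : ContDiff ℝ (⊤ : ℕ∞) φ)
    (h2 : HasCompactSupport φ) (h3 : tsupport φ ⊆ Ω) : Admissible Ω (fun _ => φ) :=
  ⟨h1.comp contDiff_snd, tsupport φ, h2, h3, fun _ => subset_tsupport φ⟩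

lemma TestFn.adm (φ : TestFn Ω) : Admissible Ω (fun _ => φ.1) :=
  admissible_of_test φ.2.1 φ.2.2.1 φ.2.2.2.1

instance : Nonempty (TestFn Ω) := by
  refine ⟨⟨fun _ => 0, contDiff_const, HasCompactSupport.zero, ?_, ?_⟩⟩
  · simp [tsupport]
  · simp [norm_gradient_sq]

lemma test_bound {P : ℝ} (hP : 0 ≤ P) (hPo : ∀ u : ℝ → Spc d → ℝ, Admissible Ω u → ∀ t,
      BB Ω u u t ≤ P * GG Ω u u t) {g : ℝ → Spc d → ℝ} (hg : Admissible Ω g) (t : ℝ)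
    (φ : TestFn Ω) : ∫ x in Ω, g t x * φ.1 x ≤ BB Ω g g t + P := by
  have h1 := BB_young hg φ.adm 1 t
  have h2 := hPo _ φ.adm t
  have h3 : GG Ω (fun _ => φ.1) (fun _ => φ.1) t ≤ 1 := by
    rw [← sqGrad_eq φ.adm]; exact φ.2.2.2.2
  have h4 : BB Ω g (fun _ => φ.1) t = ∫ x in Ω, g t x * φ.1 x := rfl
  have h5 := BB_nonneg (Ω := Ω) (u := g) t
  have h6 := mul_le_mul_of_nonneg_left h3 hP
  rw [← h4]
  linarith

lemma negH1_bdd {P : ℝ} (hP : 0 ≤ P) (hPo : ∀ u : ℝ → Spc d → ℝ, Admissible Ω u → ∀ t,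
      BB Ω u u t ≤ P * GG Ω u u t) {g : ℝ → Spc d → ℝ} (hg : Admissible Ω g) (t : ℝ) :
    BddAbove (Set.range fun φ : TestFn Ω => ∫ x in Ω, g t x * φ.1 x) := by
  refine ⟨BB Ω g g t + P, ?_⟩
  rintro _ ⟨φ, rfl⟩
  exact test_bound hP hPo hg t φ

lemma negH1_le {P : ℝ} (hP : 0 ≤ P) (hPo : ∀ u : ℝ → Spc d → ℝ, Admissible Ω u → ∀ t,
      BB Ω u u t ≤ P * GG Ω u u t) {g : ℝ → Spc d → ℝ} (hg : Admissible Ω g) (t : ℝ) :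
    negH1 Ω (g t) ≤ BB Ω g g t + P := by
  rw [negH1_eq]
  exact ciSup_le fun φ => test_bound hP hPo hg t φ

lemma negH1_nonneg {P : ℝ} (hP : 0 ≤ P) (hPo : ∀ u : ℝ → Spc d → ℝ, Admissible Ω u → ∀ t,
      BB Ω u u t ≤ P * GG Ω u u t) {g : ℝ → Spc d → ℝ} (hg : Admissible Ω g) (t : ℝ) :
    0 ≤ negH1 Ω (g t) := by
  rw [negH1_eq]
  let z : TestFn Ω := ⟨fun _ => 0, contDiff_const, HasCompactSupport.zero,
    by simp [tsupport], by simp [norm_gradient_sq]⟩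
  have := le_ciSup (negH1_bdd hP hPo hg t) z
  simpa [z] using this

lemma negH1_measurable {P : ℝ} (hP : 0 ≤ P) (hPo : ∀ u : ℝ → Spc d → ℝ, Admissible Ω u → ∀ t,
      BB Ω u u t ≤ P * GG Ω u u t) {g : ℝ → Spc d → ℝ} (hg : Admissible Ω g) :
    Measurable (fun t => negH1 Ω (g t)) := by
  simp only [negH1_eq]
  apply LowerSemicontinuous.measurable
  apply lowerSemicontinuous_ciSup (fun t => negH1_bdd hP hPo hg t)
  intro φ
  apply Continuous.lowerSemicontinuous
  exact continuous_iff_continuousAt.2 fun t => (BB_hasDerivAt hg φ.adm t).continuousAt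

lemma BB_continuous {u w : ℝ → Spc d → ℝ} (hu : Admissible Ω u) (hw : Admissible Ω w) :
    Continuous (BB Ω u w) :=
  continuous_iff_continuousAt.2 fun t => (BB_hasDerivAt hu hw t).continuousAt

lemma GG_continuous {u w : ℝ → Spc d → ℝ} (hu : Admissible Ω u) (hw : Admissible Ω w) :
    Continuous (GG Ω u w) :=
  continuous_iff_continuousAt.2 fun t => (GG_hasDerivAt hu hw t).continuousAt

lemma negH1_integrable {P : ℝ} (hP : 0 ≤ P) (hPo : ∀ u : ℝ → Spc d → ℝ, Admissible Ω u → ∀ t,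
      BB Ω u u t ≤ P * GG Ω u u t) {g : ℝ → Spc d → ℝ} (hg : Admissible Ω g) (T : ℝ) :
    IntegrableOn (fun t => t * negH1 Ω (g t) ^ 2) (Set.Icc 0 T) := by
  have hc : Continuous (fun t => t * (BB Ω g g t + P) ^ 2) := by
    have := BB_continuous hg hg
    fun_prop
  refine Integrable.mono' (hc.continuousOn.integrableOn_compact isCompact_Icc) ?_ ?_
  · exact (measurable_id.mul ((negH1_measurable hP hPo hg).pow_const 2)).aestronglyMeasurable
  · refine (ae_restrict_mem measurableSet_Icc).mono fun t ht => ?_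
    have h1 := negH1_nonneg hP hPo hg t
    have h2 := negH1_le hP hPo hg t
    rw [Real.norm_of_nonneg (mul_nonneg ht.1 (sq_nonneg _))]
    exact mul_le_mul_of_nonneg_left (pow_le_pow_left₀ h1 h2 2) ht.1

lemma dual_bound {P : ℝ} (hP : 0 ≤ P) (hPo : ∀ u : ℝ → Spc d → ℝ, Admissible Ω u → ∀ t,
      BB Ω u u t ≤ P * GG Ω u u t) {g u : ℝ → Spc d → ℝ} (hg : Admissible Ω g)
    (hu : Admissible Ω u) (t : ℝ) :
    BB Ω g u t ≤ negH1 Ω (g t) * Real.sqrt (GG Ω u u t) := by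
  have key : ∀ s : ℝ, 0 < s → Real.sqrt (GG Ω u u t) ≤ s → BB Ω g u t ≤ negH1 Ω (g t) * s := by
    intro s hs hle
    have ha : Admissible Ω (fun _ : ℝ => fun x => s⁻¹ * u t x) := by
      apply admissible_of_test (φ := fun x => s⁻¹ * u t x)
      · exact contDiff_const.mul (hu.slice t)
      · exact (hu.compactSupport t).mul_left (f := fun _ => s⁻¹)
      · exact (tsupport_mul_subset_right (f := fun _ => s⁻¹)).trans (hu.tsupport_subset t)
    have hG : GG Ω (fun _ : ℝ => fun x => s⁻¹ * u t x) (fun _ : ℝ => fun x => s⁻¹ * u t x) t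
        = (s⁻¹) ^ 2 * GG Ω u u t := by
      have : ∀ i x, pd i (fun _ : ℝ => fun x => s⁻¹ * u t x) t x = s⁻¹ * pd i u t x := by
        intro i x
        simp only [pd]
        rw [fderiv_const_mul ((hu.slice t).differentiable (by simp) x)]
        simp
      simp only [GG, BB, this, Finset.mul_sum]
      refine Finset.sum_congr rfl fun i _ => ?_
      rw [← integral_const_mul]
      congr 1; ext x; ring
    let φ : TestFn Ω := ⟨fun x => s⁻¹ * u t x, ha.slice 0, ha.compactSupport 0,
      ha.tsupport_subset 0, by
        have h1 := sqGrad_eq ha t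
        rw [hG] at h1
        change sqGrad Ω (fun x => s⁻¹ * u t x) ≤ 1
        rw [h1]
        have h2 : GG Ω u u t ≤ s ^ 2 := (Real.sqrt_le_left hs.le).1 hle
        rw [inv_pow, inv_mul_le_iff₀ (by positivity)]
        linarith⟩
    have h := le_ciSup (negH1_bdd hP hPo hg t) φ
    rw [← negH1_eq] at h
    have h2 : ∫ x in Ω, g t x * φ.1 x = s⁻¹ * BB Ω g u t := by
      simp only [BB, φ]
      rw [← integral_const_mul]
      congr 1; ext x; ring
    simp only [h2] at h
    rw [inv_mul_le_iff₀ hs] at h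
    linarith
  have hN := negH1_nonneg hP hPo hg t
  refine le_of_forall_pos_le_add fun ε hε => ?_
  have h1 : 0 < ε / (negH1 Ω (g t) + 1) := by positivity
  have := key (Real.sqrt (GG Ω u u t) + ε / (negH1 Ω (g t) + 1))
    (by positivity) (by linarith)
  have h2 : negH1 Ω (g t) * (ε / (negH1 Ω (g t) + 1)) ≤ ε := by
    rw [mul_div_assoc', div_le_iff₀ (by positivity)]
    nlinarith
  rw [mul_add] at this
  linarith

end Dual

/-! ### Energy identities -/

section Energy
variable {Ω : Set (Spc d)} {ψ f : ℝ → Spc d → ℝ} {b c T : ℝ}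

lemma BB_lin (hψ : Admissible Ω ψ) (hf : Admissible Ω f) {v y : ℝ → Spc d → ℝ}
    (hv : Admissible Ω v) (hy : Admissible Ω y) (z : ℝ → Spc d → ℝ) (t : ℝ)
    (h : ∀ x, z t x = b * LL v t x + c ^ 2 * LL ψ t x + f t x) :
    BB Ω z y t = - b * GG Ω v y t - c ^ 2 * GG Ω ψ y t + BB Ω f y t := by
  have h1 : BB Ω z y t = b * BB Ω (LL v) y t + c ^ 2 * BB Ω (LL ψ) y t + BB Ω f y t := by
    simp only [BB, h]
    rw [← integral_const_mul, ← integral_const_mul, ← integral_add, ← integral_add]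
    · congr 1; ext x; ring
    · exact ((BB_int hv.LL hy t).const_mul _).add ((BB_int hψ.LL hy t).const_mul _)
    · exact BB_int hf hy t
    · exact (BB_int hv.LL hy t).const_mul _
    · exact (BB_int hψ.LL hy t).const_mul _
  rw [h1, green hv hy, green hψ hy]
  ring

lemma heat_all (hψ : Admissible Ω ψ) (hf : Admissible Ω f) {t : ℝ} (h : IsHeat Ω b c ψ f t)
    (x : Spc d) :
    tderiv (tderiv ψ) t x = b * LL (tderiv ψ) t x + c ^ 2 * LL ψ t x + f t x := by
  by_cases hx : x ∈ Ω
  · have := h x hx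
    rw [lap_eq, lap_eq] at this
    linarith
  · rw [hψ.tderiv.tderiv.zero_off t x hx, hψ.tderiv.LL.zero_off t x hx, hψ.LL.zero_off t x hx,
      hf.zero_off t x hx]
    ring

lemma heat_deriv (hψ : Admissible Ω ψ) (hf : Admissible Ω f)
    (h : ∀ t ∈ Set.Icc (0:ℝ) T, IsHeat Ω b c ψ f t) {t : ℝ} (ht : t ∈ Set.Ioo 0 T) (x : Spc d) :
    tderiv (tderiv (tderiv ψ)) t x
      = b * LL (tderiv (tderiv ψ)) t x + c ^ 2 * LL (tderiv ψ) t x + tderiv f t x := by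
  have hd : ∀ w, Admissible Ω w → HasDerivAt (fun s => w s x) (tderiv w t x) t := by
    intro w hw
    rw [tderiv_eq hw.cd]
    exact tderiv_hasDerivAt hw.cd t x
  have h1 := hd _ hψ.tderiv.tderiv
  have h2 := (((hd _ hψ.tderiv.LL).const_mul b).add ((hd _ hψ.LL).const_mul (c ^ 2))).add (hd _ hf)
  rw [tderiv_LL hψ.tderiv, tderiv_LL hψ] at h2
  refine h1.unique (h2.congr_of_eventuallyEq ?_)
  filter_upwards [Icc_mem_nhds ht.1 ht.2] with s hs
  exact heat_all hψ hf (h s hs) x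

end Energy

/-- The pointwise (in time) differential inequality. -/
lemma diff_ineq {b c T t M Bzz Bff Bfz Gvv Gpv Gpp Gzz Gvz N Bgz S L : ℝ} (hb : 0 < b)
    (hM : M = c ^ 4 / b + 1) (ht0 : 0 ≤ t) (htT : t ≤ T)
    (hBzz : 0 ≤ Bzz) (hGvv : 0 ≤ Gvv) (hGpp : 0 ≤ Gpp) (hS : S ^ 2 = Gzz)
    (hL : L = (2 * c ^ 2 + 2 * M + 2 * T * c ^ 4 / b) * (2 / b) + M)
    (y1 : 2 * 1 * Bfz ≤ 1 ^ 2 * Bff + Bzz)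
    (y2 : 2 * 1 * Gpv ≤ 1 ^ 2 * Gpp + Gvv)
    (y3 : 2 * (-(2 * c ^ 2 / b)) * Gvz ≤ (-(2 * c ^ 2 / b)) ^ 2 * Gvv + Gzz)
    (y4 : 2 * (-(2 * c ^ 2 / b)) * Gpv ≤ (-(2 * c ^ 2 / b)) ^ 2 * Gpp + Gvv)
    (y5 : Bgz ≤ N * S) :
    (Bzz + 2 * t * (-b * Gzz - c ^ 2 * Gvz + Bgz)
        + 2 * (-Bzz + Bfz + c ^ 2 * Gvv + 2 * M * Gpv))
      - L * (t * Bzz + 2 * (b / 2 * Gvv + c ^ 2 * Gpv + M * Gpp))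
      ≤ Bff + 2 / b * (t * N ^ 2) - b * (t * Gzz) := by
  have hM0 : 0 ≤ M := by rw [hM]; positivity
  have hT0 : 0 ≤ T := ht0.trans htT
  -- lower bound of the energy
  have hE : b / 2 * Gvv + 2 * Gpp ≤ 2 * (b / 2 * Gvv + c ^ 2 * Gpv + M * Gpp) := by
    have := mul_le_mul_of_nonneg_left y4 (by positivity : 0 ≤ b / 2)
    have e1 : b / 2 * (2 * (-(2 * c ^ 2 / b)) * Gpv) = - (2 * c ^ 2 * Gpv) := by
      field_simp
    have e2 : b / 2 * ((-(2 * c ^ 2 / b)) ^ 2 * Gpp + Gvv)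
        = 2 * (c ^ 4 / b) * Gpp + b / 2 * Gvv := by
      field_simp
    rw [e1, e2] at this
    rw [hM]
    linarith
  have hZ : 2 * (-b * Gzz - c ^ 2 * Gvz + Bgz)
      ≤ -b * Gzz + 2 * c ^ 4 / b * Gvv + 2 / b * N ^ 2 := by
    have := mul_le_mul_of_nonneg_left y3 (by positivity : 0 ≤ b / 2)
    have e1 : b / 2 * (2 * (-(2 * c ^ 2 / b)) * Gvz) = - (2 * c ^ 2 * Gvz) := by
      field_simp
    have e2 : b / 2 * ((-(2 * c ^ 2 / b)) ^ 2 * Gvv + Gzz)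
        = 2 * c ^ 4 / b * Gvv + b / 2 * Gzz := by
      field_simp
    rw [e1, e2] at this
    have e3 : 2 * (N * S) ≤ b / 2 * Gzz + 2 / b * N ^ 2 := by
      have h0 : 0 ≤ b / 2 * (S - 2 / b * N) ^ 2 := by positivity
      have h1 : b / 2 * (S - 2 / b * N) ^ 2 = b / 2 * S ^ 2 - 2 * (N * S) + 2 / b * N ^ 2 := by
        field_simp
        ring
      rw [h1, hS] at h0
      linarith
    linarith
  have hZt := mul_le_mul_of_nonneg_left hZ ht0
  have hTt : t * (2 * c ^ 4 / b * Gvv) ≤ T * (2 * c ^ 4 / b * Gvv) :=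
    mul_le_mul_of_nonneg_right htT (by positivity)
  have hL0 : 0 ≤ L := by rw [hL]; positivity
  have hLE := mul_le_mul_of_nonneg_left hE hL0
  have hLz : 0 ≤ L * (t * Bzz) := by positivity
  have hMy := mul_le_mul_of_nonneg_left y2 hM0
  have hLow : (2 * c ^ 2 + 2 * M + 2 * T * c ^ 4 / b) * Gvv + 2 * M * Gpp
      ≤ L * (b / 2 * Gvv + 2 * Gpp) := by
    have e : L * (b / 2 * Gvv + 2 * Gpp)
        = ((2 * c ^ 2 + 2 * M + 2 * T * c ^ 4 / b) * Gvv + 2 * M * Gpp)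
        + (M * (b / 2 * Gvv)
        + 2 * ((2 * c ^ 2 + 2 * M + 2 * T * c ^ 4 / b) * (2 / b)) * Gpp) := by
      rw [hL]
      field_simp
      ring
    rw [e]
    have : 0 ≤ M * (b / 2 * Gvv)
        + 2 * ((2 * c ^ 2 + 2 * M + 2 * T * c ^ 4 / b) * (2 / b)) * Gpp := by positivity
    linarith
  have e5 : T * (2 * c ^ 4 / b * Gvv) = 2 * T * c ^ 4 / b * Gvv := by ring
  rw [e5] at hTt
  nlinarith

/-- time-weighted estimate on v_t for the nonlocal heat equation. -/
theorem heat_weighted_vt_estimate (d : ℕ) (hd : d = 1 ∨ d = 2 ∨ d = 3)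
    (Ω : Set (Spc d)) (hne : Ω.Nonempty) (hop : IsOpen Ω) (hbd : Bornology.IsBounded Ω)
    (b c : ℝ) (hb : 0 < b) (hc : 0 < c) (T : ℝ) (hT : 0 < T) :
    ∃ C > (0:ℝ),
      ∀ ψ f : ℝ → Spc d → ℝ, Admissible Ω ψ → Admissible Ω f →
        (∀ t ∈ Set.Icc (0:ℝ) T, IsHeat Ω b c ψ f t) →
        supIcc T (fun t => t * sqL2 Ω (tderiv (tderiv ψ) t))
          + (∫ t in (0:ℝ)..T, t * sqGrad Ω (tderiv (tderiv ψ) t))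
        ≤ C * (sqH1 Ω (ψ 0) + sqH1 Ω (tderiv ψ 0)
            + (∫ t in (0:ℝ)..T, sqL2 Ω (f t))
            + ∫ t in (0:ℝ)..T, t * (negH1 Ω (tderiv f t)) ^ 2) := by
  have hd0 : 0 < d := by omega
  obtain ⟨P, hP, hPo⟩ := poincare hd0 hbd
  obtain ⟨M, hM⟩ : ∃ M : ℝ, M = c ^ 4 / b + 1 := ⟨_, rfl⟩
  obtain ⟨L, hL⟩ : ∃ L : ℝ, L = (2 * c ^ 2 + 2 * M + 2 * T * c ^ 4 / b) * (2 / b) + M := ⟨_, rfl⟩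
  have hM0 : 0 < M := by rw [hM]; positivity
  have hL0 : 0 < L := by rw [hL]; positivity
  obtain ⟨K, hK⟩ : ∃ K : ℝ, K = b + c ^ 2 + 2 * M + 1 + 2 / b := ⟨_, rfl⟩
  have hK0 : 0 < K := by rw [hK]; positivity
  refine ⟨exp (L * T) * (1 + 1 / b) * K, by positivity, fun ψ f hψ hf hheat => ?_⟩
  have hv := hψ.tderiv
  have hz := hv.tderiv
  have hg := hf.tderiv
  set v := tderiv ψ with hvdef
  set z := tderiv v with hzdef
  set g := tderiv f with hgdef
  have eG : ∀ t, sqGrad Ω (z t) = GG Ω z z t := fun t => sqGrad_eq hz t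
  simp only [sqH1, sqL2_eq, eG]
  rw [sqGrad_eq hψ, sqGrad_eq hv]
  -- the energy functional
  let H : ℝ → ℝ := fun t => t * BB Ω z z t
    + 2 * (b / 2 * GG Ω v v t + c ^ 2 * GG Ω ψ v t + M * GG Ω ψ ψ t)
  have hHd : ∀ t, HasDerivAt H (1 * BB Ω z z t + t * (BB Ω (tderiv z) z t + BB Ω z (tderiv z) t)
      + 2 * (b / 2 * (GG Ω z v t + GG Ω v z t) + c ^ 2 * (GG Ω v v t + GG Ω ψ z t)
        + M * (GG Ω v ψ t + GG Ω ψ v t))) t := by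
    intro t
    exact ((hasDerivAt_id t).mul (BB_hasDerivAt hz hz t)).add
      (((((GG_hasDerivAt hv hv t).const_mul (b / 2)).add
        ((GG_hasDerivAt hψ hv t).const_mul (c ^ 2))).add
        ((GG_hasDerivAt hψ hψ t).const_mul M)).const_mul 2)
  have hHd' : ∀ t ∈ Set.Ioo 0 T, HasDerivAt H
      (BB Ω z z t + 2 * t * (-b * GG Ω z z t - c ^ 2 * GG Ω v z t + BB Ω g z t)
        + 2 * (-BB Ω z z t + BB Ω f z t + c ^ 2 * GG Ω v v t + 2 * M * GG Ω ψ v t)) t := by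
    intro t ht
    have h1 := BB_lin hψ hf hv hz z t
      (heat_all hψ hf (hheat t ⟨ht.1.le, ht.2.le⟩))
    have h2 := BB_lin hv hg hz hz (tderiv z) t (heat_deriv hψ hf hheat ht)
    convert hHd t using 1
    rw [BB_comm (u := z) (w := tderiv z), h2, GG_comm (u := z) (w := v),
      GG_comm (u := v) (w := ψ)]
    linear_combination (-2) * h1
  have hineq : ∀ t ∈ Set.Ioo 0 T,
      (BB Ω z z t + 2 * t * (-b * GG Ω z z t - c ^ 2 * GG Ω v z t + BB Ω g z t)
        + 2 * (-BB Ω z z t + BB Ω f z t + c ^ 2 * GG Ω v v t + 2 * M * GG Ω ψ v t)) - L * H t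
      ≤ BB Ω f f t + 2 / b * (t * negH1 Ω (g t) ^ 2) - b * (t * GG Ω z z t) := by
    intro t ht
    exact diff_ineq hb hM ht.1.le ht.2.le (BB_nonneg t) (GG_nonneg t) (GG_nonneg t)
      (Real.sq_sqrt (GG_nonneg t)) hL (BB_young hf hz 1 t) (GG_young hψ hv 1 t)
      (GG_young hv hz _ t) (by
        have := GG_young hψ hv (-(2 * c ^ 2 / b)) t
        exact this) (dual_bound hP hPo hg hz t)
  have hHnn : ∀ t, 0 ≤ t → t * BB Ω z z t ≤ H t := by
    intro t ht
    have y4 := GG_young hψ hv (-(2 * c ^ 2 / b)) t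
    have := mul_le_mul_of_nonneg_left y4 (by positivity : 0 ≤ b / 2)
    have e1 : b / 2 * (2 * (-(2 * c ^ 2 / b)) * GG Ω ψ v t) = - (2 * c ^ 2 * GG Ω ψ v t) := by
      field_simp
    have e2 : b / 2 * ((-(2 * c ^ 2 / b)) ^ 2 * GG Ω ψ ψ t + GG Ω v v t)
        = 2 * (c ^ 4 / b) * GG Ω ψ ψ t + b / 2 * GG Ω v v t := by
      field_simp
    rw [e1, e2] at this
    have h1 : 0 ≤ b / 2 * GG Ω v v t := mul_nonneg (by positivity) (GG_nonneg t)
    have h2 : 0 ≤ GG Ω ψ ψ t := GG_nonneg t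
    simp only [H]
    rw [hM]
    linarith
  -- integrability
  have iN := negH1_integrable hP hPo hg T
  have iF : Continuous (BB Ω f f) := BB_continuous hf hf
  have iZ : Continuous (fun t => t * GG Ω z z t) := by
    have := GG_continuous hz hz
    fun_prop
  have iR : IntegrableOn (fun t => BB Ω f f t + 2 / b * (t * negH1 Ω (g t) ^ 2)) (Set.Icc 0 T) :=
    (iF.continuousOn.integrableOn_compact isCompact_Icc).add (iN.const_mul _)
  have iRi : ∀ t ∈ Set.Icc 0 T, IntervalIntegrable
      (fun t => BB Ω f f t + 2 / b * (t * negH1 Ω (g t) ^ 2)) volume 0 t := by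
    intro t ht
    rw [intervalIntegrable_iff_integrableOn_Icc_of_le ht.1]
    exact iR.mono_set (Set.Icc_subset_Icc le_rfl ht.2)
  have iNi : IntervalIntegrable (fun t => t * negH1 Ω (g t) ^ 2) volume 0 T := by
    rw [intervalIntegrable_iff_integrableOn_Icc_of_le hT.le]
    exact iN
  -- Gronwall
  have key : ∀ t ∈ Set.Icc 0 T, exp (-(L * T)) * H t
      + exp (-(L * T)) * b * ∫ s in (0:ℝ)..t, s * GG Ω z z s
      ≤ H 0 + ∫ s in (0:ℝ)..T, (BB Ω f f s + 2 / b * (s * negH1 Ω (g s) ^ 2)) := by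
    intro t ht
    have hexp : ∀ s, HasDerivAt (fun s => exp (-(L * s))) (exp (-(L * s)) * (-(L * 1))) s :=
      fun s => (((hasDerivAt_id s).const_mul L).neg).exp
    have hcont : Continuous (fun s => exp (-(L * s)) * H s) :=
      continuous_iff_continuousAt.2 fun s => ((hexp s).mul (hHd s)).continuousAt
    have main := intervalIntegral.sub_le_integral_of_hasDeriv_right_of_le
      (g := fun s => exp (-(L * s)) * H s)
      (φ := fun s => (BB Ω f f s + 2 / b * (s * negH1 Ω (g s) ^ 2))
        - exp (-(L * T)) * b * (s * GG Ω z z s)) ht.1 hcont.continuousOn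
      (fun s hs => ((hexp s).mul (hHd' s ⟨hs.1, hs.2.trans_le ht.2⟩)).hasDerivWithinAt)
      ((iR.mono_set (Set.Icc_subset_Icc le_rfl ht.2)).sub
        ((iZ.continuousOn.integrableOn_compact isCompact_Icc).const_mul _)) ?_
    · rw [intervalIntegral.integral_sub (iRi t ht) ((iZ.intervalIntegrable _ _).const_mul _),
        intervalIntegral.integral_const_mul] at main
      have hmono : ∫ s in (0:ℝ)..t, (BB Ω f f s + 2 / b * (s * negH1 Ω (g s) ^ 2))
          ≤ ∫ s in (0:ℝ)..T, (BB Ω f f s + 2 / b * (s * negH1 Ω (g s) ^ 2)) := by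
        apply intervalIntegral.integral_mono_interval le_rfl ht.1 ht.2 _ (iRi T ⟨hT.le, le_rfl⟩)
        refine (ae_restrict_mem measurableSet_Ioc).mono fun s hs => ?_
        exact add_nonneg (BB_nonneg s)
          (mul_nonneg (by positivity) (mul_nonneg hs.1.le (sq_nonneg _)))
      have hH0 : 0 ≤ H t := (mul_nonneg ht.1 (BB_nonneg t)).trans (hHnn t ht.1)
      have he : exp (-(L * T)) ≤ exp (-(L * t)) := by
        apply exp_le_exp.2
        have := mul_le_mul_of_nonneg_left ht.2 hL0.le
        linarith
      have h3 := mul_le_mul_of_nonneg_right he hH0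
      simp only [mul_zero, neg_zero, exp_zero, one_mul] at main
      linarith
    · intro s hs
      have hsT : s ∈ Set.Ioo 0 T := ⟨hs.1, hs.2.trans_le ht.2⟩
      have h1 := mul_le_mul_of_nonneg_left (hineq s hsT) (exp_pos (-(L * s))).le
      have he1 : exp (-(L * s)) ≤ 1 := by
        apply exp_le_one_iff.2
        have := mul_pos hL0 hs.1
        linarith
      have he2 : exp (-(L * T)) ≤ exp (-(L * s)) := by
        apply exp_le_exp.2
        have := mul_le_mul_of_nonneg_left hsT.2.le hL0.le
        linarith
      have h2 : 0 ≤ BB Ω f f s + 2 / b * (s * negH1 Ω (g s) ^ 2) := add_nonneg (BB_nonneg s)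
          (mul_nonneg (by positivity) (mul_nonneg hs.1.le (sq_nonneg _)))
      have h3 := mul_le_mul_of_nonneg_right he1 h2
      have h4 := mul_le_mul_of_nonneg_right he2
        (mul_nonneg hb.le (mul_nonneg hs.1.le (GG_nonneg (Ω := Ω) (u := z) s)))
      linarith
  -- the right-hand side
  have hψ0 : 0 ≤ BB Ω ψ ψ 0 := BB_nonneg 0
  have hv0 : 0 ≤ BB Ω v v 0 := BB_nonneg 0
  have hGψ0 : 0 ≤ GG Ω ψ ψ 0 := GG_nonneg 0
  have hGv0 : 0 ≤ GG Ω v v 0 := GG_nonneg 0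
  have hIf : 0 ≤ ∫ t in (0:ℝ)..T, BB Ω f f t :=
    intervalIntegral.integral_nonneg hT.le fun t _ => BB_nonneg t
  have hIN : 0 ≤ ∫ t in (0:ℝ)..T, t * negH1 Ω (g t) ^ 2 :=
    intervalIntegral.integral_nonneg hT.le fun t ht => mul_nonneg ht.1 (sq_nonneg _)
  set If := ∫ t in (0:ℝ)..T, BB Ω f f t with hIfdef
  set IN := ∫ t in (0:ℝ)..T, t * negH1 Ω (g t) ^ 2 with hINdef
  have hRHS : H 0 + ∫ s in (0:ℝ)..T, (BB Ω f f s + 2 / b * (s * negH1 Ω (g s) ^ 2))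
      ≤ K * (BB Ω ψ ψ 0 + GG Ω ψ ψ 0 + (BB Ω v v 0 + GG Ω v v 0) + If + IN) := by
    rw [intervalIntegral.integral_add (iF.intervalIntegrable _ _) (iNi.const_mul _),
      intervalIntegral.integral_const_mul, ← hIfdef, ← hINdef]
    have y2 := GG_young hψ hv 1 0
    have hcy := mul_le_mul_of_nonneg_left y2 (sq_nonneg c)
    have hH0 : H 0 ≤ (b + c ^ 2) * GG Ω v v 0 + (c ^ 2 + 2 * M) * GG Ω ψ ψ 0 := by
      simp only [H]
      linarith
    have h2b : 0 < 2 / b := by positivity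
    have hc2 : 0 < c ^ 2 := by positivity
    have k1 : (b + c ^ 2) * GG Ω v v 0 ≤ K * GG Ω v v 0 :=
      mul_le_mul_of_nonneg_right (by rw [hK]; linarith) hGv0
    have k2 : (c ^ 2 + 2 * M) * GG Ω ψ ψ 0 ≤ K * GG Ω ψ ψ 0 :=
      mul_le_mul_of_nonneg_right (by rw [hK]; linarith) hGψ0
    have k3 : 1 * If ≤ K * If :=
      mul_le_mul_of_nonneg_right (by rw [hK]; linarith) hIf
    have k4 : 2 / b * IN ≤ K * IN :=
      mul_le_mul_of_nonneg_right (by rw [hK]; linarith) hIN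
    have k5 := mul_nonneg hK0.le hψ0
    have k6 := mul_nonneg hK0.le hv0
    linarith
  set S := BB Ω ψ ψ 0 + GG Ω ψ ψ 0 + (BB Ω v v 0 + GG Ω v v 0) + If + IN with hS
  have hee : exp (L * T) * exp (-(L * T)) = 1 := by
    rw [← exp_add]; simp
  have hIZ : ∀ t ∈ Set.Icc 0 T, 0 ≤ ∫ s in (0:ℝ)..t, s * GG Ω z z s := fun t ht =>
    intervalIntegral.integral_nonneg ht.1 fun s hs => mul_nonneg hs.1 (GG_nonneg s)
  have key2 : ∀ t ∈ Set.Icc 0 T, H t + b * ∫ s in (0:ℝ)..t, s * GG Ω z z s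
      ≤ exp (L * T) * (K * S) := by
    intro t ht
    have h1 := mul_le_mul_of_nonneg_left ((key t ht).trans hRHS) (exp_pos (L * T)).le
    have h2 : exp (L * T) * (exp (-(L * T)) * H t
      + exp (-(L * T)) * b * ∫ s in (0:ℝ)..t, s * GG Ω z z s)
      = (exp (L * T) * exp (-(L * T))) * (H t + b * ∫ s in (0:ℝ)..t, s * GG Ω z z s) := by ring
    rw [h2, hee, one_mul] at h1
    exact h1
  have hsup : supIcc T (fun t => t * BB Ω z z t) ≤ exp (L * T) * (K * S) := by
    haveI : Nonempty (Set.Icc (0:ℝ) T) := ⟨⟨0, le_rfl, hT.le⟩⟩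
    refine ciSup_le fun t => ?_
    have h1 := key2 t.1 t.2
    have h2 := hHnn t.1 t.2.1
    have h3 := mul_nonneg hb.le (hIZ t.1 t.2)
    linarith
  have hint : ∫ s in (0:ℝ)..T, s * GG Ω z z s ≤ 1 / b * (exp (L * T) * (K * S)) := by
    have hTm : T ∈ Set.Icc 0 T := ⟨hT.le, le_rfl⟩
    have h1 := key2 T hTm
    have h2 := (mul_nonneg hT.le (BB_nonneg (Ω := Ω) (u := z) T)).trans (hHnn T hT.le)
    rw [one_div, le_inv_mul_iff₀ hb]
    linarith
  calc _ ≤ exp (L * T) * (K * S) + 1 / b * (exp (L * T) * (K * S)) := add_le_add hsup hint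
    _ = _ := by ring
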